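/- arXiv:2306.01777 — 2 statements merged into one kernel-verified Lean document; each statement's English description precedes it below -/
import Mathlib

section
/- Entropy dissipation identity for the one-species nonlocal equation. Let d ≥ 2, T > 0, ε > 0, and let ρ ∈ C_c^∞(ℝ^d) be nonnegative with ∫ρ = 1; set ρ_ε(x) = ε^{−d}ρ(x/ε). Let u : [0,T]×ℝ^d → (0,∞) be a strictly positive classical solution of ∂_t u = div( u ∇(ρ̌_ε*ρ_ε*u) ), jointly smooth, such that u(t,·) and all its spatial derivatives are Schwartz functions locally uniformly in t, and such that u ln u and |x|² u are integrable in x locally uniformly in t. Then for every t ∈ [0,T]: ∫_{ℝ^d} u(t,x) ln u(t,x) dx + ∫_0^t ∫_{ℝ^d} |∇(ρ_ε*u)(s,x)|² dx ds = ∫_{ℝ^d} u(0,x) ln u(0,x) dx. -/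
open MeasureTheory Real Set ENNReal RealInnerProductSpace Filter

noncomputable section

/-- `ℝ^d` as a Euclidean space. -/
abbrev Rd (d : ℕ) := EuclideanSpace ℝ (Fin d)

/-- Convolution of two real-valued functions on `ℝ^d`. -/
def conv {d : ℕ} (f g : Rd d → ℝ) : Rd d → ℝ := fun x => ∫ y, f (x - y) * g y

/-- Rescaled kernel `ρ_ε(x) = ε^{-d} ρ(x/ε)`. -/
def resc {d : ℕ} (ε : ℝ) (ρ : Rd d → ℝ) : Rd d → ℝ := fun x => (ε ^ d)⁻¹ * ρ (ε⁻¹ • x)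

/-- Reflection `ρ̌(x) = ρ(-x)`. -/
def refle {d : ℕ} (ρ : Rd d → ℝ) : Rd d → ℝ := fun x => ρ (-x)

/-- Spatial divergence of a vector field on `ℝ^d`. -/
def sdiv {d : ℕ} (F : Rd d → Rd d) (x : Rd d) : ℝ :=
  ∑ i : Fin d, fderiv ℝ (fun y => F y i) x (EuclideanSpace.single i (1:ℝ))

/-- Laplacian of a function on `ℝ^d`. -/
def slap {d : ℕ} (f : Rd d → ℝ) (x : Rd d) : ℝ :=
  ∑ i : Fin d, fderiv ℝ (fun y => fderiv ℝ f y (EuclideanSpace.single i (1:ℝ))) x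
    (EuclideanSpace.single i (1:ℝ))

/-- `u(t,·)` and all its spatial derivatives are Schwartz, (locally) uniformly in `t ∈ [0,T]`. -/
def SchwartzUnif (T : ℝ) {d : ℕ} (u : ℝ → Rd d → ℝ) : Prop :=
  ∀ n k : ℕ, ∃ C : ℝ, ∀ t ∈ Icc (0:ℝ) T, ∀ x : Rd d,
    ‖x‖ ^ n * ‖iteratedFDeriv ℝ k (u t) x‖ ≤ C

theorem conv_eq_convolution {d : ℕ} (f g : Rd d → ℝ) :
    conv f g = convolution f g (ContinuousLinearMap.mul ℝ ℝ) volume := by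
  funext x
  rw [convolution_eq_swap]
  rfl

theorem conv_eq' {d : ℕ} (f g : Rd d → ℝ) (x : Rd d) :
    conv f g x = ∫ y, f y * g (x - y) := by
  rw [conv_eq_convolution]
  rfl

theorem conv_bound {d : ℕ} {K g : Rd d → ℝ} (hK : Integrable K) {C : ℝ}
    (hg : ∀ x, |g x| ≤ C) (x : Rd d) : |conv K g x| ≤ (∫ y, |K y|) * C := by
  rw [conv_eq', ← integral_mul_const, ← Real.norm_eq_abs]
  apply norm_integral_le_of_norm_le (hK.abs.mul_const C)
  filter_upwards with y
  rw [norm_mul]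
  exact mul_le_mul_of_nonneg_left (hg _) (abs_nonneg _)

theorem conv_hasFDerivAt {d : ℕ} {K f : Rd d → ℝ} (hK : Integrable K) {C : ℝ}
    (hf : ContDiff ℝ 1 f) (h0 : ∀ x, |f x| ≤ C) (h1 : ∀ x, ‖fderiv ℝ f x‖ ≤ C) (x : Rd d) :
    HasFDerivAt (conv K f) (∫ y, K y • fderiv ℝ f (x - y)) x := by
  have hc : Continuous (fderiv ℝ f) := hf.continuous_fderiv (by norm_num)
  have : conv K f = fun x => ∫ y, K y * f (x - y) := funext (conv_eq' K f)
  rw [this]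
  have hm : ∀ x, AEStronglyMeasurable (fun y => K y * f (x - y)) volume := fun x =>
    hK.aestronglyMeasurable.mul (hf.continuous.comp (by fun_prop)).aestronglyMeasurable
  apply hasFDerivAt_integral_of_dominated_of_fderiv_le (bound := fun y => |K y| * C)
    (s := univ) (F' := fun x y => K y • fderiv ℝ f (x - y)) Filter.univ_mem
  · exact Filter.Eventually.of_forall hm
  · apply (hK.abs.mul_const C).mono' (hm x)
    filter_upwards with y
    rw [norm_mul]
    exact mul_le_mul_of_nonneg_left (h0 _) (abs_nonneg _)
  · exact hK.aestronglyMeasurable.smul (hc.comp (by fun_prop)).aestronglyMeasurable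
  · filter_upwards with y x _
    rw [norm_smul]
    exact mul_le_mul_of_nonneg_left (h1 _) (abs_nonneg _)
  · exact hK.abs.mul_const C
  · filter_upwards with y x _
    have h := ((hf.differentiable (by norm_num)) (x - y)).hasFDerivAt
    have h2 : HasFDerivAt (fun x : Rd d => x - y) (ContinuousLinearMap.id ℝ (Rd d)) x :=
      (hasFDerivAt_id x).sub_const y
    have h3 := (h.comp x h2).const_mul (K y)
    simpa using h3

theorem conv_fderiv_apply {d : ℕ} {K f : Rd d → ℝ} (hK : Integrable K) {C : ℝ}
    (hf : ContDiff ℝ 1 f) (h0 : ∀ x, |f x| ≤ C) (h1 : ∀ x, ‖fderiv ℝ f x‖ ≤ C) (x v : Rd d) :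
    fderiv ℝ (conv K f) x v = conv K (fun y => fderiv ℝ f y v) x := by
  have hc : Continuous (fderiv ℝ f) := hf.continuous_fderiv (by norm_num)
  rw [(conv_hasFDerivAt hK hf h0 h1 x).fderiv, conv_eq', ContinuousLinearMap.integral_apply]
  · rfl
  · apply (hK.abs.mul_const C).mono'
      (hK.aestronglyMeasurable.smul (hc.comp (by fun_prop)).aestronglyMeasurable)
    filter_upwards with y
    change ‖K y • fderiv ℝ f (x - y)‖ ≤ _
    rw [norm_smul]
    exact mul_le_mul_of_nonneg_left (h1 _) (abs_nonneg _)

theorem conv_self_adj {d : ℕ} {η g : Rd d → ℝ} (hη : Continuous η) (hηc : HasCompactSupport η)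
    (hg : Continuous g) (hgi : Integrable g) {C : ℝ} (hC : ∀ x, |g x| ≤ C) :
    Integrable (fun x => conv η g x ^ 2) ∧
    ∫ x, g x * conv (conv (refle η) η) g x = ∫ x, conv η g x ^ 2 := by
  have hηi : Integrable η := hη.integrable_of_hasCompactSupport hηc
  have hη' : Continuous (refle η) := hη.comp continuous_neg
  have hηc' : HasCompactSupport (refle η) := hηc.comp_homeomorph (Homeomorph.neg _)
  have hh : Continuous (conv η g) := by
    rw [conv_eq_convolution]
    exact hηc.continuous_convolution_left _ hη hg.locallyIntegrable
  have hhi : Integrable (conv η g) := by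
    rw [conv_eq_convolution]
    exact hηi.integrable_convolution _ hgi
  have hhb := conv_bound hηi hC
  have hassoc : ∀ x, conv (conv (refle η) η) g x = conv (refle η) (conv η g) x := by
    intro x
    simp only [conv_eq_convolution]
    apply convolution_assoc
    · intro x y z; simp [mul_assoc]
    · exact hη'.aestronglyMeasurable
    · exact hη.aestronglyMeasurable
    · exact hg.aestronglyMeasurable
    · exact Filter.Eventually.of_forall
        (hηc'.convolutionExists_left _ hη' hη.locallyIntegrable)
    · exact Filter.Eventually.of_forall
        (hηc.norm.convolutionExists_left _ hη.norm hg.norm.locallyIntegrable)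
    · exact hηc'.norm.convolutionExists_left _ hη'.norm
        (hηc.norm.continuous_convolution_left _ hη.norm hg.norm.locallyIntegrable).locallyIntegrable x
  constructor
  · simp only [sq]
    exact hhi.bdd_mul hh.aestronglyMeasurable (Filter.Eventually.of_forall hhb)
  · have hint := hgi.convolution_integrand (ContinuousLinearMap.mul ℝ ℝ) hηi
    have hint2 : Integrable (fun p : Rd d × Rd d => conv η g p.1 * (g p.2 * η (p.1 - p.2)))
        (volume.prod volume) := by
      apply hint.bdd_mul (hh.comp continuous_fst).aestronglyMeasurable
        (Filter.Eventually.of_forall fun p => hhb p.1)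
    have hsw := integral_integral_swap
      (f := fun y x => conv η g y * (g x * η (y - x))) hint2
    calc ∫ x, g x * conv (conv (refle η) η) g x
        = ∫ x, ∫ y, conv η g y * (g x * η (y - x)) := by
          congr 1; funext x
          rw [hassoc, conv, ← integral_const_mul]
          congr 1; funext y
          simp only [refle, neg_sub]; ring
      _ = ∫ y, ∫ x, conv η g y * (g x * η (y - x)) := hsw.symm
      _ = ∫ x, conv η g x ^ 2 := by
          congr 1; funext y
          rw [integral_const_mul, sq]
          congr 1
          rw [conv]
          congr 1; funext x; ring

theorem landau {d : ℕ} {f : Rd d → ℝ} (hf : ContDiff ℝ 2 f) (hpos : ∀ x, 0 < f x) {M : ℝ}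
    (h2 : ∀ x, ‖fderiv ℝ (fderiv ℝ f) x‖ ≤ M) (x v : Rd d) (hv : ‖v‖ = 1) :
    |fderiv ℝ f x v| ≤ 2 * √M * √(f x) := by
  have hM : 0 ≤ M := le_trans (by positivity) (h2 0)
  have hd1 : Differentiable ℝ f := hf.differentiable (by norm_num)
  have hd2 : Differentiable ℝ (fderiv ℝ f) :=
    (hf.fderiv_right (m := 1) (by norm_num)).differentiable (by norm_num)
  have key : ∀ h : ℝ, 0 ≤ M * (h * h) + fderiv ℝ f x v * h + f x := by
    intro h
    have hb : ∀ z ∈ Metric.closedBall x |h|, ‖fderiv ℝ f z - fderiv ℝ f x‖ ≤ M * |h| := by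
      intro z hz
      have := Convex.norm_image_sub_le_of_norm_fderiv_le (𝕜 := ℝ) (f := fderiv ℝ f) (s := univ)
        (C := M) (x := x) (y := z) (fun z _ => hd2 z) (fun z _ => h2 z) convex_univ trivial trivial
      refine this.trans (mul_le_mul_of_nonneg_left ?_ hM)
      simpa [dist_eq_norm] using hz
    have := Convex.norm_image_sub_le_of_norm_fderiv_le' (𝕜 := ℝ) (f := f)
      (s := Metric.closedBall x |h|) (x := x) (y := x + h • v)
      (fun z _ => hd1 z) hb (convex_closedBall _ _) (by simp) (by simp [norm_smul, hv])
    simp only [add_sub_cancel_left, map_smul, smul_eq_mul, norm_smul, hv, mul_one,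
      Real.norm_eq_abs] at this
    have h3 := (abs_le.1 this).2
    have h4 := hpos (x + h • v)
    have h5 : M * |h| * |h| = M * (h * h) := by rw [mul_assoc, abs_mul_abs_self]
    nlinarith
  have hdis := discrim_le_zero key
  rw [discrim] at hdis
  apply abs_le_of_sq_le_sq _ (by positivity)
  rw [mul_pow, mul_pow, Real.sq_sqrt hM, Real.sq_sqrt (hpos x).le]
  linarith

theorem scalar_bound {u C P : ℝ} (hu : 0 < u) (hP : 0 ≤ P) (hP1 : P ≤ 1) (hC : 1 ≤ C)
    (h : u ≤ C * P ^ 4) : √u * (1 + |Real.log u|) ≤ 9 * C ^ 3 * P := by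
  obtain ⟨v, hv, rfl⟩ : ∃ v : ℝ, 0 < v ∧ v ^ 4 = u := by
    refine ⟨√√u, by positivity, ?_⟩
    rw [show (4:ℕ) = 2 * 2 from rfl, pow_mul, Real.sq_sqrt (by positivity), Real.sq_sqrt hu.le]
  have hvC : v ≤ C * P := by
    apply le_of_pow_le_pow_left₀ (n := 4) (by norm_num) (by positivity)
    rw [mul_pow]
    refine h.trans (mul_le_mul_of_nonneg_right ?_ (by positivity))
    exact le_self_pow₀ hC (by norm_num)
  have hvC' : v ≤ C := hvC.trans (by nlinarith)
  have h1 : √(v ^ 4) = v ^ 2 := by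
    rw [show v ^ 4 = (v ^ 2) ^ 2 by ring, Real.sqrt_sq (by positivity)]
  have h2 : |Real.log (v ^ 4)| ≤ 4 * (v + v⁻¹) := by
    rw [Real.log_pow, abs_mul]
    have ha : Real.log v ≤ v := (Real.log_le_sub_one_of_pos hv).trans (by linarith)
    have hb : -Real.log v ≤ v⁻¹ := by
      rw [← Real.log_inv]
      exact (Real.log_le_sub_one_of_pos (inv_pos.2 hv)).trans (by linarith)
    have : |Real.log v| ≤ v + v⁻¹ := by
      have := inv_pos.2 hv
      exact abs_le.2 ⟨by linarith, by linarith⟩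
    norm_num
    linarith
  rw [h1]
  calc v ^ 2 * (1 + |Real.log (v ^ 4)|) ≤ v ^ 2 * (1 + 4 * (v + v⁻¹)) := by gcongr
    _ = v * (v + 4 * v ^ 2 + 4) := by field_simp; ring
    _ ≤ (C * P) * (C ^ 2 + 4 * C ^ 2 + 4 * C ^ 2) := by
        gcongr
        · nlinarith
        · nlinarith
    _ = _ := by ring

def Pw {d : ℕ} (x : Rd d) : ℝ := ((1 + ‖x‖) ^ (d + 1))⁻¹

theorem Pw_pos {d : ℕ} (x : Rd d) : 0 < Pw x := by unfold Pw; positivity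

theorem Pw_le_one {d : ℕ} (x : Rd d) : Pw x ≤ 1 := by
  unfold Pw
  apply inv_le_one_of_one_le₀
  exact one_le_pow₀ (by linarith [norm_nonneg x])

theorem Pw_integrable {d : ℕ} : Integrable (Pw (d := d)) := by
  have := integrable_one_add_norm (E := Rd d) (μ := volume) (r := ((d + 1 : ℕ) : ℝ)) (by simp)
  refine this.congr (Filter.Eventually.of_forall fun x => ?_)
  simp only [Pw]
  rw [Real.rpow_neg (by positivity), Real.rpow_natCast]

theorem schwartz_bound {d : ℕ} {T : ℝ} {u : ℝ → Rd d → ℝ} (h : SchwartzUnif T u) (k : ℕ) :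
    ∃ C : ℝ, 1 ≤ C ∧ ∀ s ∈ Icc (0:ℝ) T, ∀ x, ‖iteratedFDeriv ℝ k (u s) x‖ ≤ C * Pw x ^ 4 := by
  obtain ⟨A, hA⟩ := h 0 k
  obtain ⟨B, hB⟩ := h ((d + 1) * 4) k
  refine ⟨max 1 (2 ^ ((d + 1) * 4 - 1) * (A + B)), le_max_left _ _, fun s hs x => ?_⟩
  have ha := hA s hs x
  have hb := hB s hs x
  rw [pow_zero, one_mul] at ha
  rw [Pw, inv_pow, ← pow_mul, ← div_eq_mul_inv, le_div_iff₀ (by positivity)]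
  refine le_trans ?_ (le_max_right _ _)
  have h1 := add_pow_le (zero_le_one (α := ℝ)) (norm_nonneg x) ((d + 1) * 4)
  calc _ ≤ ‖iteratedFDeriv ℝ k (u s) x‖ *
        (2 ^ ((d + 1) * 4 - 1) * (1 ^ ((d + 1) * 4) + ‖x‖ ^ ((d + 1) * 4))) := by gcongr
    _ = 2 ^ ((d + 1) * 4 - 1) * (‖iteratedFDeriv ℝ k (u s) x‖ +
        ‖x‖ ^ ((d + 1) * 4) * ‖iteratedFDeriv ℝ k (u s) x‖) := by rw [one_pow]; ring
    _ ≤ _ := by gcongr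

theorem gradient_coord {d : ℕ} (F : Rd d → ℝ) (x : Rd d) (i : Fin d) :
    gradient F x i = fderiv ℝ F x (EuclideanSpace.single i (1:ℝ)) := by
  rw [gradient, ← InnerProductSpace.toDual_symm_apply (𝕜 := ℝ), EuclideanSpace.inner_single_right]
  simp

theorem fixed_time {d : ℕ} {η f : Rd d → ℝ} (hη : Continuous η) (hηc : HasCompactSupport η)
    (hf : ContDiff ℝ 2 f) (hpos : ∀ x, 0 < f x) {C : ℝ} (hC : 1 ≤ C)
    (h0 : ∀ x, f x ≤ C * Pw x ^ 4) (h1 : ∀ x, ‖fderiv ℝ f x‖ ≤ C * Pw x ^ 4)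
    (h2 : ∀ x, ‖fderiv ℝ (fderiv ℝ f) x‖ ≤ C * Pw x ^ 4) :
    (∀ x, |(1 + Real.log (f x)) *
      sdiv (fun y => f y • gradient (conv (conv (refle η) η) f) y) x| ≤
      d * (3 * C * ((∫ y, |conv (refle η) η y|) * C) * (9 * C ^ 3 * Pw x))) ∧
    ∫ x, (1 + Real.log (f x)) * sdiv (fun y => f y • gradient (conv (conv (refle η) η) f) y) x
      = - ∫ x, ‖gradient (conv η f) x‖ ^ 2 := by
  have hηi : Integrable η := hη.integrable_of_hasCompactSupport hηc
  have hη' : Continuous (refle η) := hη.comp continuous_neg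
  have hηc' : HasCompactSupport (refle η) := hηc.comp_homeomorph (Homeomorph.neg _)
  have hK : Integrable (conv (refle η) η) := by
    rw [conv_eq_convolution]
    exact (hη'.integrable_of_hasCompactSupport hηc').integrable_convolution _ hηi
  have hKη := fun g : Rd d → ℝ => conv_self_adj (g := g) hη hηc
  generalize hKdef : conv (refle η) η = K at *
  set W : ℝ := (∫ y, |K y|) * C with hW
  have hW0 : 0 ≤ W := by
    have : 0 ≤ ∫ y, |K y| := integral_nonneg fun y => abs_nonneg _
    positivity
  have hP4 : ∀ x : Rd d, C * Pw x ^ 4 ≤ C := fun x => by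
    have := pow_le_one₀ (n := 4) (Pw_pos x).le (Pw_le_one x)
    nlinarith
  have hP4' : ∀ x : Rd d, C * Pw x ^ 4 ≤ C * Pw x := fun x => by
    have := pow_le_of_le_one (Pw_pos x).le (Pw_le_one x) (n := 4) (by norm_num)
    gcongr
  have hfc : Continuous f := hf.continuous
  have hfd : Differentiable ℝ f := hf.differentiable (by norm_num)
  have hf1 : ContDiff ℝ 1 f := hf.of_le (by norm_num)
  have b0 : ∀ x, |f x| ≤ C := fun x => by
    rw [abs_of_pos (hpos x)]; exact (h0 x).trans (hP4 x)
  have b1 : ∀ x, ‖fderiv ℝ f x‖ ≤ C := fun x => (h1 x).trans (hP4 x)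
  have hsf : ∀ x, f x ≤ C * √(f x) := fun x => by
    have hs : √(f x) ≤ C := by
      rw [Real.sqrt_le_left (by linarith)]
      have := (h0 x).trans (hP4 x)
      nlinarith
    calc f x = √(f x) * √(f x) := (Real.mul_self_sqrt (hpos x).le).symm
      _ ≤ _ := by gcongr
  -- partial derivatives
  set e : Fin d → Rd d := fun i => EuclideanSpace.single i (1:ℝ) with he
  have hen : ∀ i, ‖e i‖ = 1 := fun i => by simp [he]
  set g : Fin d → Rd d → ℝ := fun i x => fderiv ℝ f x (e i) with hgdef
  have hff : ContDiff ℝ 1 (fderiv ℝ f) := hf.fderiv_right (by norm_num)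
  have hg1 : ∀ i, ContDiff ℝ 1 (g i) := fun i => hff.clm_apply contDiff_const
  have hgb' : ∀ i x, |g i x| ≤ C * Pw x ^ 4 := fun i x => by
    have := (fderiv ℝ f x).le_opNorm (e i)
    rw [hen, mul_one] at this
    exact this.trans (h1 x)
  have hgb : ∀ i x, |g i x| ≤ C := fun i x => (hgb' i x).trans (hP4 x)
  have hgd : ∀ i x, ‖fderiv ℝ (g i) x‖ ≤ C := fun i x => by
    have h3 : HasFDerivAt (g i) ((fderiv ℝ (fderiv ℝ f) x).flip (e i)) x := by
      have := (hff.differentiable (by norm_num) x).hasFDerivAt.clm_apply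
        (hasFDerivAt_const (e i) x)
      simpa using this
    rw [h3.fderiv]
    refine ((fderiv ℝ (fderiv ℝ f) x).flip.le_opNorm (e i)).trans ?_
    rw [hen, mul_one, ContinuousLinearMap.opNorm_flip]
    exact (h2 x).trans (hP4 x)
  have hgi : ∀ i, Integrable (g i) := fun i => by
    apply (Pw_integrable.const_mul C).mono' (hg1 i).continuous.aestronglyMeasurable
    exact Filter.Eventually.of_forall fun x => (hgb' i x).trans (hP4' x)
  have hgL : ∀ i x, |g i x| ≤ 2 * C * √(f x) := fun i x => by
    refine (landau hf hpos (fun x => (h2 x).trans (hP4 x)) x (e i) (hen i)).trans ?_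
    have : √C ≤ C := by
      rw [Real.sqrt_le_left (by linarith)]; nlinarith
    gcongr
  -- w
  have hw1 : ∀ i x, fderiv ℝ (conv K f) x (e i) = conv K (g i) x := fun i x =>
    conv_fderiv_apply hK hf1 b0 b1 x (e i)
  have hwb : ∀ i x, |conv K (g i) x| ≤ W := fun i x => conv_bound hK (hgb i) x
  have hwd : ∀ i, Differentiable ℝ (conv K (g i)) := fun i x =>
    (conv_hasFDerivAt hK (hg1 i) (hgb i) (hgd i) x).differentiableAt
  have hwdb : ∀ i x, |fderiv ℝ (conv K (g i)) x (e i)| ≤ W := fun i x => by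
    rw [conv_fderiv_apply hK (hg1 i) (hgb i) (hgd i)]
    apply conv_bound hK
    intro y
    have := (fderiv ℝ (g i) y).le_opNorm (e i)
    rw [hen, mul_one] at this
    exact this.trans (hgd i y)
  have hsd : ∀ x, sdiv (fun y => f y • gradient (conv K f) y) x =
      ∑ i, fderiv ℝ (fun y => f y * conv K (g i) y) x (e i) := by
    intro x
    unfold _root_.sdiv
    congr 1; funext i
    congr 2; funext y
    rw [PiLp.smul_apply, gradient_coord, smul_eq_mul]
    rw [← hw1]
  have hprod : ∀ i x, fderiv ℝ (fun y => f y * conv K (g i) y) x (e i) =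
      f x * fderiv ℝ (conv K (g i)) x (e i) + conv K (g i) x * g i x := by
    intro i x
    rw [fderiv_fun_mul (hfd x) (hwd i x)]
    simp [hgdef]
  have hlog : ∀ x, √(f x) * |1 + Real.log (f x)| ≤ 9 * C ^ 3 * Pw x := fun x => by
    refine le_trans ?_ (scalar_bound (hpos x) (Pw_pos x).le (Pw_le_one x) hC (h0 x))
    gcongr
    refine (abs_add_le _ _).trans ?_
    simp
  have hterm : ∀ (G D : ℝ) (x : Rd d), 0 ≤ D → |G| ≤ D * √(f x) →
      |(1 + Real.log (f x)) * G| ≤ D * (9 * C ^ 3 * Pw x) := by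
    intro G D x hD hG
    rw [abs_mul]
    calc _ ≤ |1 + Real.log (f x)| * (D * √(f x)) := by gcongr
      _ = D * (√(f x) * |1 + Real.log (f x)|) := by ring
      _ ≤ _ := mul_le_mul_of_nonneg_left (hlog x) hD
  have hterm1 : ∀ i x, |(1 + Real.log (f x)) * fderiv ℝ (fun y => f y * conv K (g i) y) x (e i)|
      ≤ 3 * C * W * (9 * C ^ 3 * Pw x) := by
    intro i x
    apply hterm _ _ _ (by positivity)
    rw [hprod]
    refine (abs_add_le _ _).trans ?_
    rw [abs_mul, abs_mul, abs_of_pos (hpos x)]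
    calc _ ≤ (C * √(f x)) * W + W * (2 * C * √(f x)) := by
          gcongr
          · exact hsf x
          · exact hwdb i x
          · exact hwb i x
          · exact hgL i x
      _ = _ := by ring
  have hterm2 : ∀ i x, |(1 + Real.log (f x)) * (f x * conv K (g i) x)|
      ≤ C * W * (9 * C ^ 3 * Pw x) := by
    intro i x
    apply hterm _ _ _ (by positivity)
    rw [abs_mul, abs_of_pos (hpos x)]
    calc _ ≤ (C * √(f x)) * W := by
          gcongr
          · exact hsf x
          · exact hwb i x
      _ = _ := by ring
  have hlogd : Differentiable ℝ (fun x => 1 + Real.log (f x)) := fun x =>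
    ((hfd x).log (hpos x).ne').const_add 1
  have hlogf : ∀ i x, fderiv ℝ (fun x => 1 + Real.log (f x)) x (e i) * (f x * conv K (g i) x)
      = g i x * conv K (g i) x := by
    intro i x
    rw [fderiv_const_add, fderiv.log (hfd x) (hpos x).ne']
    simp only [smul_apply, smul_eq_mul, hgdef]
    have := (hpos x).ne'
    field_simp
  have I1 : ∀ i, Integrable (fun x => (1 + Real.log (f x)) *
      fderiv ℝ (fun y => f y * conv K (g i) y) x (e i)) := by
    intro i
    apply ((Pw_integrable.const_mul (9 * C ^ 3)).const_mul (3 * C * W)).mono'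
    · exact hlogd.continuous.aestronglyMeasurable.mul
        (measurable_fderiv_apply_const ℝ _ (e i)).aestronglyMeasurable
    · exact Filter.Eventually.of_forall (hterm1 i)
  have I2 : ∀ i, Integrable (fun x => (1 + Real.log (f x)) * (f x * conv K (g i) x)) := by
    intro i
    apply ((Pw_integrable.const_mul (9 * C ^ 3)).const_mul (C * W)).mono'
    · exact (hlogd.continuous.mul (hfc.mul (hwd i).continuous)).aestronglyMeasurable
    · exact Filter.Eventually.of_forall (hterm2 i)
  have I3 : ∀ i, Integrable (fun x => g i x * conv K (g i) x) := by
    intro i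
    exact (hgi i).mul_bdd (hwd i).continuous.aestronglyMeasurable
      (Filter.Eventually.of_forall (hwb i))
  have ibp : ∀ i, ∫ x, (1 + Real.log (f x)) * fderiv ℝ (fun y => f y * conv K (g i) y) x (e i)
      = - ∫ x, conv η (g i) x ^ 2 := by
    intro i
    rw [← (hKη (g i) (hg1 i).continuous (hgi i) (hgb i)).2]
    rw [integral_mul_fderiv_eq_neg_fderiv_mul_of_integrable]
    · simp only [hlogf]
    · simp only [hlogf]
      exact I3 i
    · exact I1 i
    · exact I2 i
    · exact fun x _ => hlogd x
    · exact fun x _ => (hfd x).mul (hwd i x)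
  constructor
  · intro x
    rw [hsd, Finset.mul_sum]
    refine (Finset.abs_sum_le_sum_abs _ _).trans ?_
    refine (Finset.sum_le_sum fun i _ => hterm1 i x).trans ?_
    simp
  · simp only [hsd, Finset.mul_sum]
    rw [integral_finsetSum _ fun i _ => I1 i]
    simp only [ibp, EuclideanSpace.norm_sq_eq, gradient_coord, Real.norm_eq_abs, sq_abs]
    rw [Finset.sum_neg_distrib, ← integral_finsetSum]
    · congr 2; funext x
      congr 1; funext i
      rw [← conv_fderiv_apply hηi hf1 b0 b1 x (e i)]
    · exact fun i _ => (hKη (g i) (hg1 i).continuous (hgi i) (hgb i)).1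

/-- Entropy dissipation identity for the one-species nonlocal equation. -/
theorem entropy_dissipation_one_species
    (d : ℕ) (hd : 2 ≤ d) (T ε : ℝ) (hT : 0 < T) (hε : 0 < ε)
    (ρ : Rd d → ℝ) (hρsmooth : ContDiff ℝ (⊤ : ℕ∞) ρ) (hρcpt : HasCompactSupport ρ)
    (hρpos : ∀ x, 0 ≤ ρ x) (hρint : ∫ x, ρ x = 1)
    (u : ℝ → Rd d → ℝ) (hupos : ∀ t x, 0 < u t x)
    (husmooth : ContDiff ℝ (⊤ : ℕ∞) (fun q : ℝ × Rd d => u q.1 q.2))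
    (huS : SchwartzUnif T u)
    (huent : ∀ t ∈ Icc (0:ℝ) T, Integrable (fun x => u t x * Real.log (u t x)))
    (humom : ∀ t ∈ Icc (0:ℝ) T, Integrable (fun x : Rd d => ‖x‖ ^ 2 * u t x))
    (hpde : ∀ t ∈ Icc (0:ℝ) T, ∀ x, deriv (fun s => u s x) t
      = sdiv (fun y => u t y •
          gradient (conv (conv (refle (resc ε ρ)) (resc ε ρ)) (u t)) y) x) :
    ∀ t ∈ Icc (0:ℝ) T,
      (∫ x, u t x * Real.log (u t x))
        + (∫ s in (0:ℝ)..t, ∫ x, ‖gradient (conv (resc ε ρ) (u s)) x‖ ^ 2)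
      = ∫ x, u 0 x * Real.log (u 0 x) := by
  intro t ht
  have hη : Continuous (resc ε ρ) := by
    have := hρsmooth.continuous
    unfold resc
    fun_prop
  have hηc : HasCompactSupport (resc ε ρ) :=
    (hρcpt.comp_smul (inv_ne_zero hε.ne')).mul_left
  have hus : ∀ s, ContDiff ℝ 2 (u s) := fun s =>
    (contDiff_infty.1 husmooth 2).comp (contDiff_const.prodMk contDiff_id)
  obtain ⟨C0, hC0, hb0⟩ := schwartz_bound huS 0
  obtain ⟨C1, hC1, hb1⟩ := schwartz_bound huS 1
  obtain ⟨C2, hC2, hb2⟩ := schwartz_bound huS 2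
  set C := max C0 (max C1 C2) with hCdef
  have hC : 1 ≤ C := hC0.trans (le_max_left _ _)
  have hP : ∀ x : Rd d, 0 ≤ Pw x ^ 4 := fun x => pow_nonneg (Pw_pos x).le 4
  have main := fun s (hs : s ∈ Icc (0:ℝ) T) =>
    fixed_time (η := resc ε ρ) (f := u s) hη hηc (hus s) (hupos s) (C := C) hC
      (fun x => by
        have := hb0 s hs x
        rw [norm_iteratedFDeriv_zero, Real.norm_eq_abs, abs_of_pos (hupos s x)] at this
        exact this.trans (mul_le_mul_of_nonneg_right (le_max_left _ _) (hP x)))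
      (fun x => by
        have := hb1 s hs x
        rw [norm_iteratedFDeriv_one] at this
        exact this.trans (mul_le_mul_of_nonneg_right
          ((le_max_left _ _).trans (le_max_right _ _)) (hP x)))
      (fun x => by
        have := hb2 s hs x
        rw [← norm_iteratedFDeriv_fderiv, norm_iteratedFDeriv_one] at this
        exact this.trans (mul_le_mul_of_nonneg_right
          ((le_max_right _ _).trans (le_max_right _ _)) (hP x)))
  set g : ℝ → Rd d → ℝ := fun s x => (1 + Real.log (u s x)) * deriv (fun s => u s x) s with hg
  have hUd : ∀ s x, HasDerivAt (fun s => u s x)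
      (fderiv ℝ (fun q : ℝ × Rd d => u q.1 q.2) (s, x) (1, 0)) s := by
    intro s x
    have h1 := ((husmooth.differentiable (by simp)) (s, x)).hasFDerivAt
    have h2 : HasDerivAt (fun s : ℝ => (s, x)) ((1 : ℝ), (0 : Rd d)) s :=
      (hasDerivAt_id s).prodMk (hasDerivAt_const s x)
    exact h1.comp_hasDerivAt s h2
  have hgc : Continuous (Function.uncurry g) := by
    have h1 : Continuous (fun q : ℝ × Rd d =>
        fderiv ℝ (fun q : ℝ × Rd d => u q.1 q.2) q (1, 0)) :=
      (husmooth.continuous_fderiv (by simp)).clm_apply continuous_const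
    have h2 : Continuous (fun q : ℝ × Rd d => Real.log (u q.1 q.2)) :=
      husmooth.continuous.log fun q => (hupos _ _).ne'
    have h3 : Function.uncurry g = fun q : ℝ × Rd d => (1 + Real.log (u q.1 q.2)) *
        fderiv ℝ (fun q : ℝ × Rd d => u q.1 q.2) q (1, 0) := by
      funext ⟨s, x⟩
      simp only [Function.uncurry, hg, (hUd s x).deriv]
    rw [h3]
    exact (continuous_const.add h2).mul h1
  have ftc : ∀ x, ∫ s in (0:ℝ)..t, g s x =
      u t x * Real.log (u t x) - u 0 x * Real.log (u 0 x) := by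
    intro x
    rw [intervalIntegral.integral_eq_sub_of_hasDerivAt (f := fun s => u s x * Real.log (u s x))]
    · intro s _
      have h1 := (hUd s x).differentiableAt.hasDerivAt
      have h2 := h1.mul (h1.log (hupos s x).ne')
      refine h2.congr_deriv ?_
      have := (hupos s x).ne'
      simp only [hg]
      field_simp
      ring
    · exact (hgc.comp (by fun_prop : Continuous fun s : ℝ => (s, x))).intervalIntegrable _ _
  have hsub : Ioc 0 t ⊆ Icc (0:ℝ) T := fun s hs => ⟨hs.1.le, hs.2.trans ht.2⟩
  have hint : Integrable (Function.uncurry g) ((volume.restrict (Ioc 0 t)).prod volume) := by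
    have hb := ((Pw_integrable (d := d)).const_mul (9 * C ^ 3)).const_mul
      (3 * C * ((∫ y, |conv (refle (resc ε ρ)) (resc ε ρ) y|) * C)) |>.const_mul (d : ℝ)
    apply (hb.comp_snd (volume.restrict (Ioc 0 t))).mono' hgc.aestronglyMeasurable
    have : (volume.restrict (Ioc 0 t)).prod (volume : Measure (Rd d)) =
        ((volume : Measure ℝ).prod volume).restrict (Ioc 0 t ×ˢ univ) := by
      rw [← Measure.prod_restrict, Measure.restrict_univ]
    rw [this]
    apply ae_restrict_of_forall_mem (measurableSet_Ioc.prod MeasurableSet.univ)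
    rintro ⟨s, x⟩ ⟨hs, -⟩
    have := (main s (hsub hs)).1 x
    rw [← hpde s (hsub hs) x] at this
    exact this
  have hswap := integral_integral_swap hint
  have e1 : ∫ s in (0:ℝ)..t, ∫ x, ‖gradient (conv (resc ε ρ) (u s)) x‖ ^ 2 =
      - ∫ s in Ioc 0 t, ∫ x, g s x := by
    rw [intervalIntegral.integral_of_le ht.1, ← integral_neg]
    apply setIntegral_congr_fun measurableSet_Ioc
    intro s hs
    have h1 := (main s (hsub hs)).2
    simp only [← hpde s (hsub hs)] at h1
    simp only [hg, h1, neg_neg]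
  have e2 : ∫ x, ∫ s in Ioc 0 t, g s x =
      (∫ x, u t x * Real.log (u t x)) - ∫ x, u 0 x * Real.log (u 0 x) := by
    rw [← integral_sub (huent t ht) (huent 0 ⟨le_rfl, hT.le⟩)]
    congr 1; funext x
    rw [← ftc, intervalIntegral.integral_of_le ht.1]
  rw [e1, hswap, e2]
  ring
end
end

section
/- Energy dissipation identity for the multi-species nonlocal system. Let d ≥ 2, T > 0, ε > 0, N ≤ p positive integers, A = (α^{ki}) ∈ M_{p×N}(ℝ), and let ρ^1,…,ρ^N be nonnegative Schwartz functions with ∫ρ^i = 1. Set ρ^i_ε(x) = ε^{−d}ρ^i(x/ε) and K^{ij}_ε = Σ_{k=1}^p α^{ki} α^{kj} (ρ̌^i_ε * ρ^j_ε). Let u^1,…,u^N : [0,T]×ℝ^d → [0,∞) be nonnegative classical solutions of ∂_t u^i = div( u^i Σ_{j=1}^N ∇(K^{ij}_ε * u^j) ), jointly smooth with each u^i(t,·) and all its spatial derivatives Schwartz locally uniformly in t. Then for every t ∈ [0,T]: Σ_{k=1}^p ∫_{ℝ^d} ( Σ_{i=1}^N α^{ki} (ρ^i_ε*u^i)(t,x)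 )² dx + 2 Σ_{i=1}^N ∫_0^t ∫_{ℝ^d} u^i(s,x) | Σ_{j=1}^N ∇(K^{ij}_ε*u^j)(s,x) |² dx ds = Σ_{k=1}^p ∫_{ℝ^d} ( Σ_{i=1}^N α^{ki} (ρ^i_ε*u^i)(0,x) )² dx. -/
open MeasureTheory Real Set ENNReal RealInnerProductSpace Filter

noncomputable section

/-- The interaction kernel `K^{ij} = Σ_k α^{ki} α^{kj} ρ̌^i * ρ^j`. -/
def Kker {d p N : ℕ} (A : Matrix (Fin p) (Fin N) ℝ) (ρ : Fin N → Rd d → ℝ)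
    (i j : Fin N) : Rd d → ℝ :=
  fun x => ∑ k : Fin p, A k i * A k j * conv (refle (ρ i)) (ρ j) x

/-- `C¹`, bounded by `C` together with its derivative. -/
def GB {d : ℕ} (C : ℝ) (f : Rd d → ℝ) : Prop :=
  ContDiff ℝ 1 f ∧ ∀ x, |f x| ≤ C ∧ ‖fderiv ℝ f x‖ ≤ C

lemma GB.nonneg {d : ℕ} {C : ℝ} {f : Rd d → ℝ} (h : GB C f) : 0 ≤ C :=
  (abs_nonneg _).trans (h.2 0).1

lemma GB.mono {d : ℕ} {C C' : ℝ} {f : Rd d → ℝ} (h : GB C f) (hC : C ≤ C') : GB C' f :=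
  ⟨h.1, fun x => ⟨(h.2 x).1.trans hC, (h.2 x).2.trans hC⟩⟩

lemma GB.diff {d : ℕ} {C : ℝ} {f : Rd d → ℝ} (h : GB C f) : Differentiable ℝ f :=
  h.1.differentiable one_ne_zero

lemma GB.cmul {d : ℕ} {C : ℝ} {f : Rd d → ℝ} (h : GB C f) (c : ℝ) :
    GB (|c| * C) (fun x => c * f x) := by
  refine ⟨contDiff_const.mul h.1, fun x => ⟨?_, ?_⟩⟩
  · rw [abs_mul]; exact mul_le_mul_of_nonneg_left (h.2 x).1 (abs_nonneg _)
  · rw [fderiv_const_mul (h.diff x), norm_smul, Real.norm_eq_abs]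
    exact mul_le_mul_of_nonneg_left (h.2 x).2 (abs_nonneg _)

lemma GB.sum {d N : ℕ} {C : Fin N → ℝ} {f : Fin N → Rd d → ℝ} (h : ∀ j, GB (C j) (f j)) :
    GB (∑ j, C j) (fun x => ∑ j, f j x) := by
  refine ⟨ContDiff.sum fun j _ => (h j).1, fun x => ⟨?_, ?_⟩⟩
  · exact (Finset.abs_sum_le_sum_abs _ _).trans (Finset.sum_le_sum fun j _ => ((h j).2 x).1)
  · rw [fderiv_fun_sum fun j _ => (h j).diff x]
    exact (norm_sum_le _ _).trans (Finset.sum_le_sum fun j _ => ((h j).2 x).2)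

lemma GB.conv_aux {d : ℕ} {C M : ℝ} {K g : Rd d → ℝ} (h : GB C K) (hg : Integrable g)
    (hM : ∫ x, |g x| ≤ M) :
    GB (C * M) (conv K g) ∧
      ∀ x v, fderiv ℝ (conv K g) x v = conv (fun z => fderiv ℝ K z v) g x := by
  have hC := h.nonneg
  have hcK : Continuous K := h.1.continuous
  have hcK' : Continuous (fderiv ℝ K) := h.1.continuous_fderiv one_ne_zero
  have hint : ∀ x, Integrable (fun y => K (x - y) * g y) := fun x =>
    hg.bdd_mul (c := C) (by fun_prop) (Eventually.of_forall fun y => (h.2 _).1)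
  have hint' : ∀ x, Integrable (fun y => g y • fderiv ℝ K (x - y)) := fun x =>
    hg.smul_bdd C (by fun_prop) (Eventually.of_forall fun y => (h.2 _).2)
  have hb : ∀ x y, ‖g y • fderiv ℝ K (x - y)‖ ≤ C * |g y| := fun x y => by
    rw [norm_smul, Real.norm_eq_abs, mul_comm]
    exact mul_le_mul_of_nonneg_right (h.2 _).2 (abs_nonneg _)
  have hd : ∀ x, HasFDerivAt (conv K g) (∫ y, g y • fderiv ℝ K (x - y)) x := by
    intro x
    refine hasFDerivAt_integral_of_dominated_of_fderiv_le (s := univ)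
      (F := fun x y => K (x - y) * g y) (F' := fun x y => g y • fderiv ℝ K (x - y))
      (bound := fun y => C * |g y|) univ_mem
      (Eventually.of_forall fun x => (hint x).aestronglyMeasurable) (hint x)
      (hint' x).aestronglyMeasurable
      (Eventually.of_forall fun y x _ => hb x y) (hg.abs.const_mul C)
      (Eventually.of_forall fun y x _ => ?_)
    have h1 : HasFDerivAt (fun x => K (x - y)) (fderiv ℝ K (x - y)) x := by
      have := (h.diff (x - y)).hasFDerivAt.comp x ((hasFDerivAt_id x).sub_const y)
      rw [ContinuousLinearMap.comp_id] at this
      exact this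
    exact h1.mul_const (g y)
  have hfd : fderiv ℝ (conv K g) = fun x => ∫ y, g y • fderiv ℝ K (x - y) :=
    funext fun x => (hd x).fderiv
  have hCM : C * ∫ x, |g x| ≤ C * M := mul_le_mul_of_nonneg_left hM hC
  refine ⟨⟨contDiff_one_iff_fderiv.2 ⟨fun x => (hd x).differentiableAt, ?_⟩, fun x => ⟨?_, ?_⟩⟩, ?_⟩
  · rw [hfd]
    exact continuous_of_dominated (bound := fun y => C * |g y|)
      (fun x => (hint' x).aestronglyMeasurable)
      (fun x => Eventually.of_forall fun y => hb x y) (hg.abs.const_mul C)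
      (Eventually.of_forall fun y => by fun_prop)
  · refine le_trans ?_ hCM
    rw [← integral_const_mul, ← Real.norm_eq_abs]
    refine norm_integral_le_of_norm_le (hg.abs.const_mul C) (Eventually.of_forall fun y => ?_)
    rw [norm_mul]
    exact mul_le_mul_of_nonneg_right (h.2 _).1 (norm_nonneg _)
  · refine le_trans ?_ hCM
    rw [← integral_const_mul, hfd]
    exact norm_integral_le_of_norm_le (hg.abs.const_mul C) (Eventually.of_forall fun y => hb x y)
  · intro x v
    rw [hfd]
    refine (ContinuousLinearMap.integral_apply (hint' x) v).trans ?_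
    simp only [conv, ContinuousLinearMap.smul_apply, smul_eq_mul]
    congr 1; ext y; ring

/-- Being the coercion of a Schwartz map. -/
def IsS {d : ℕ} (f : Rd d → ℝ) : Prop := ∃ S : SchwartzMap (Rd d) ℝ, ⇑S = f

lemma IsS.integrable {d : ℕ} {f : Rd d → ℝ} (h : IsS f) : Integrable f := by
  obtain ⟨S, rfl⟩ := h; exact S.integrable

lemma IsS.gb {d : ℕ} {f : Rd d → ℝ} (h : IsS f) : ∃ C, GB C f := by
  obtain ⟨S, rfl⟩ := h
  obtain ⟨C0, h0⟩ := S.decay 0 0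
  obtain ⟨C1, h1⟩ := S.decay 0 1
  refine ⟨max C0 C1, S.smooth 1, fun x => ⟨?_, ?_⟩⟩
  · have := h0.2 x
    simp at this
    exact this.trans (le_max_left _ _)
  · have := h1.2 x
    rw [pow_zero, one_mul, norm_iteratedFDeriv_one] at this
    exact this.trans (le_max_right _ _)

lemma IsS.fd {d : ℕ} {f : Rd d → ℝ} (h : IsS f) (v : Rd d) : IsS (fun z => fderiv ℝ f z v) := by
  obtain ⟨S, rfl⟩ := h
  exact ⟨LineDeriv.lineDerivOp v S, funext fun x => SchwartzMap.lineDerivOp_apply_eq_fderiv v S x⟩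

lemma IsS.refle {d : ℕ} {f : Rd d → ℝ} (h : IsS f) : IsS (refle f) := by
  obtain ⟨S, rfl⟩ := h
  exact ⟨SchwartzMap.compCLMOfContinuousLinearEquiv ℝ (ContinuousLinearEquiv.neg ℝ) S, rfl⟩

lemma IsS.resc {d : ℕ} {f : Rd d → ℝ} (h : IsS f) {ε : ℝ} (hε : 0 < ε) : IsS (resc ε f) := by
  obtain ⟨S, rfl⟩ := h
  refine ⟨(ε ^ d)⁻¹ • SchwartzMap.compCLMOfContinuousLinearEquiv ℝ
    (ContinuousLinearEquiv.smulLeft (Units.mk0 ε⁻¹ (inv_ne_zero hε.ne'))) S, ?_⟩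
  ext x
  simp [_root_.resc]

lemma Kker_eq {d p N : ℕ} (A : Matrix (Fin p) (Fin N) ℝ) (φ : Fin N → Rd d → ℝ) (i j : Fin N) :
    Kker A φ i j = fun x => (∑ k, A k i * A k j) * conv (refle (φ i)) (φ j) x := by
  ext x; simp only [Kker, Finset.sum_mul]

lemma Kker_gb {d p N : ℕ} (A : Matrix (Fin p) (Fin N) ℝ) (φ : Fin N → Rd d → ℝ)
    (hφ : ∀ i, IsS (φ i)) (i j : Fin N) :
    (∃ C, GB C (Kker A φ i j)) ∧ ∀ v, ∃ C, GB C (fun z => fderiv ℝ (Kker A φ i j) z v) := by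
  rw [Kker_eq]
  obtain ⟨C, hC⟩ := (hφ i).refle.gb
  have h1 := hC.conv_aux (hφ j).integrable le_rfl
  refine ⟨⟨_, h1.1.cmul _⟩, fun v => ?_⟩
  obtain ⟨C', hC'⟩ := ((hφ i).refle.fd v).gb
  have h2 := hC'.conv_aux (hφ j).integrable le_rfl
  refine ⟨|∑ k, A k i * A k j| * (C' * ∫ x, |φ j x|), ?_⟩
  convert h2.1.cmul (∑ k, A k i * A k j) using 1
  ext z
  rw [fderiv_const_mul (h1.1.diff z), ContinuousLinearMap.smul_apply, h1.2, smul_eq_mul]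

lemma conv_symm {d : ℕ} (f g : Rd d → ℝ) (z : Rd d) :
    conv (refle f) g z = conv (refle g) f (-z) := by
  simp only [conv, refle]
  rw [← integral_add_right_eq_self (μ := volume) _ z]
  congr 1; ext y
  rw [mul_comm]; congr 2 <;> abel

lemma Kker_symm {d p N : ℕ} (A : Matrix (Fin p) (Fin N) ℝ) (φ : Fin N → Rd d → ℝ) (i j : Fin N)
    (z : Rd d) : Kker A φ i j z = Kker A φ j i (-z) := by
  simp only [Kker]
  refine Finset.sum_congr rfl fun k _ => ?_
  rw [conv_symm, mul_comm (A k i)]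

lemma V_lem {d N : ℕ} (K : Fin N → Rd d → ℝ) (hK : ∀ j, ∃ C, GB C (K j))
    (hK' : ∀ j v, ∃ C, GB C (fun z => fderiv ℝ (K j) z v)) (M : ℝ) (hM : 0 ≤ M) :
    ∃ C, ∀ g : Fin N → Rd d → ℝ, (∀ j, Integrable (g j)) → (∀ j, ∫ x, |g j x| ≤ M) →
      GB C (fun x => ∑ j, conv (K j) (g j) x) ∧
      (∀ a : Fin d, GB C (fun z => fderiv ℝ (fun x => ∑ j, conv (K j) (g j) x) z
        (EuclideanSpace.single a (1:ℝ)))) ∧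
      ∀ x, ∑ j, gradient (conv (K j) (g j)) x = gradient (fun x => ∑ j, conv (K j) (g j) x) x := by
  choose C hC using hK
  choose C' hC' using hK'
  have n1 : 0 ≤ ∑ j, C j * M := Finset.sum_nonneg fun j _ => mul_nonneg (hC j).nonneg hM
  have n2 : ∀ a : Fin d, 0 ≤ ∑ j, C' j (EuclideanSpace.single a (1:ℝ)) * M := fun a =>
    Finset.sum_nonneg fun j _ => mul_nonneg (hC' j _).nonneg hM
  refine ⟨∑ j, C j * M + ∑ a : Fin d, ∑ j, C' j (EuclideanSpace.single a (1:ℝ)) * M,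
    fun g hg hgM => ?_⟩
  have h1 := fun j => (hC j).conv_aux (hg j) (hgM j)
  refine ⟨(GB.sum fun j => (h1 j).1).mono ?_, fun a => ?_, fun x => ?_⟩
  · have := Finset.sum_nonneg fun a (_ : a ∈ Finset.univ) => n2 a
    linarith
  · have h2 := fun j => (hC' j (EuclideanSpace.single a (1:ℝ))).conv_aux (hg j) (hgM j)
    have h3 := GB.sum fun j => (h2 j).1
    have : (fun z => fderiv ℝ (fun x => ∑ j, conv (K j) (g j) x) z
        (EuclideanSpace.single a (1:ℝ))) = fun x => ∑ j, conv (fun z => fderiv ℝ (K j) z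
        (EuclideanSpace.single a (1:ℝ))) (g j) x := by
      ext z
      rw [fderiv_fun_sum fun j _ => (h1 j).1.diff z, _root_.sum_apply]
      exact Finset.sum_congr rfl fun j _ => (h1 j).2 z _
    rw [this]
    refine h3.mono ?_
    have := Finset.single_le_sum (fun a _ => n2 a) (Finset.mem_univ a)
    linarith
  · simp only [gradient]
    rw [fderiv_fun_sum fun j _ => (h1 j).1.diff x, map_sum]

/-- Integrable weight. -/
def wt {d : ℕ} (x : Rd d) : ℝ := (1 + ‖x‖) ^ (-((d : ℝ) + 1))

lemma wt_nonneg {d : ℕ} (x : Rd d) : 0 ≤ wt x := by unfold wt; positivity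

lemma wt_integrable {d : ℕ} : Integrable (wt (d := d)) := by
  unfold wt
  apply integrable_one_add_norm
  simp

lemma wt_eq {d : ℕ} (x : Rd d) : wt x = ((1 + ‖x‖) ^ (d + 1))⁻¹ := by
  unfold wt
  rw [Real.rpow_neg (by positivity)]
  congr 1
  exact_mod_cast Real.rpow_natCast (1 + ‖x‖) (d + 1)

lemma int_of_wt {d : ℕ} {h : Rd d → ℝ} {c : ℝ} (hc : Continuous h) (hb : ∀ x, |h x| ≤ c * wt x) :
    Integrable h :=
  (wt_integrable.const_mul c).mono' hc.aestronglyMeasurable (Eventually.of_forall hb)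

lemma decay_lem {d : ℕ} {T : ℝ} {u : ℝ → Rd d → ℝ} (hu : SchwartzUnif T u) (k : ℕ) :
    ∃ C, 0 ≤ C ∧ ∀ t ∈ Icc (0:ℝ) T, ∀ x, ‖iteratedFDeriv ℝ k (u t) x‖ ≤ C * wt x := by
  obtain ⟨C0, h0⟩ := hu 0 k
  obtain ⟨C1, h1⟩ := hu (d + 1) k
  refine ⟨2 ^ d * (|C0| + |C1|), by positivity, fun t ht x => ?_⟩
  have a0 := (h0 t ht x).trans (le_abs_self _)
  have a1 := (h1 t ht x).trans (le_abs_self _)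
  rw [pow_zero, one_mul] at a0
  rw [wt_eq, ← div_eq_mul_inv, le_div_iff₀ (by positivity)]
  have := add_pow_le (zero_le_one (α := ℝ)) (norm_nonneg x) (d + 1)
  rw [one_pow, Nat.add_sub_cancel] at this
  set n := ‖iteratedFDeriv ℝ k (u t) x‖
  have hn : 0 ≤ n := norm_nonneg _
  calc n * (1 + ‖x‖) ^ (d + 1) ≤ n * (2 ^ d * (1 + ‖x‖ ^ (d + 1))) :=
        mul_le_mul_of_nonneg_left this hn
    _ = 2 ^ d * (n + ‖x‖ ^ (d + 1) * n) := by ring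
    _ ≤ _ := by gcongr

lemma prod_lem {d : ℕ} {T C c c' : ℝ} {K : Rd d → ℝ} (hK : Continuous K) (hC : ∀ x, |K x| ≤ C)
    {f g : ℝ → Rd d → ℝ} (hf : Continuous fun q : ℝ × Rd d => f q.1 q.2)
    (hg : Continuous fun q : ℝ × Rd d => g q.1 q.2)
    (bf : ∀ t ∈ Icc (0:ℝ) T, ∀ x, |f t x| ≤ c * wt x)
    (bg : ∀ t ∈ Icc (0:ℝ) T, ∀ x, |g t x| ≤ c' * wt x) :
    (∀ t ∈ Icc (0:ℝ) T, Integrable fun z : Rd d × Rd d => K (z.1 - z.2) * (f t z.1 * g t z.2)) ∧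
    ContinuousOn (fun t => ∫ z : Rd d × Rd d, K (z.1 - z.2) * (f t z.1 * g t z.2)) (Icc 0 T) ∧
    (∀ t ∈ Icc (0:ℝ) T, ∀ z : Rd d × Rd d, ‖K (z.1 - z.2) * (f t z.1 * g t z.2)‖ ≤
      C * ((c * wt z.1) * (c' * wt z.2))) ∧
    ∀ t, Continuous fun z : Rd d × Rd d => K (z.1 - z.2) * (f t z.1 * g t z.2) := by
  have hf1 : ∀ t, Continuous (f t) := fun t => hf.comp (by fun_prop : Continuous fun x => (t, x))
  have hg1 : ∀ t, Continuous (g t) := fun t => hg.comp (by fun_prop : Continuous fun x => (t, x))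
  have hf2 : ∀ x, Continuous (fun t => f t x) :=
    fun x => hf.comp (by fun_prop : Continuous fun t => (t, x))
  have hg2 : ∀ x, Continuous (fun t => g t x) :=
    fun x => hg.comp (by fun_prop : Continuous fun t => (t, x))
  have hc : ∀ t, Continuous fun z : Rd d × Rd d => K (z.1 - z.2) * (f t z.1 * g t z.2) :=
    fun t => by fun_prop
  have hb : ∀ t ∈ Icc (0:ℝ) T, ∀ z : Rd d × Rd d, ‖K (z.1 - z.2) * (f t z.1 * g t z.2)‖ ≤
      C * ((c * wt z.1) * (c' * wt z.2)) := fun t ht z => by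
    rw [norm_mul, norm_mul]
    exact mul_le_mul (hC _) (mul_le_mul (bf t ht _) (bg t ht _) (norm_nonneg _)
      ((abs_nonneg _).trans (bf t ht _))) (by positivity) ((abs_nonneg _).trans (hC 0))
  have hi : Integrable fun z : Rd d × Rd d => C * ((c * wt z.1) * (c' * wt z.2)) :=
    ((wt_integrable.const_mul c).mul_prod (wt_integrable.const_mul c')).const_mul C
  refine ⟨fun t ht => hi.mono' (hc t).aestronglyMeasurable (Eventually.of_forall (hb t ht)), ?_,
    hb, hc⟩
  exact continuousOn_of_dominated (fun t _ => (hc t).aestronglyMeasurable)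
    (fun t ht => Eventually.of_forall (hb t ht)) hi
    (Eventually.of_forall fun z => (by fun_prop : Continuous _).continuousOn)

lemma deriv_lem {d : ℕ} {T C c c' : ℝ} {K : Rd d → ℝ} (hK : Continuous K) (hC : ∀ x, |K x| ≤ C)
    {f g f' g' : ℝ → Rd d → ℝ} (hf : Continuous fun q : ℝ × Rd d => f q.1 q.2)
    (hg : Continuous fun q : ℝ × Rd d => g q.1 q.2)
    (hf' : Continuous fun q : ℝ × Rd d => f' q.1 q.2)
    (hg' : Continuous fun q : ℝ × Rd d => g' q.1 q.2)
    (bf : ∀ t ∈ Icc (0:ℝ) T, ∀ x, |f t x| ≤ c * wt x)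
    (bg : ∀ t ∈ Icc (0:ℝ) T, ∀ x, |g t x| ≤ c * wt x)
    (bf' : ∀ t ∈ Icc (0:ℝ) T, ∀ x, |f' t x| ≤ c' * wt x)
    (bg' : ∀ t ∈ Icc (0:ℝ) T, ∀ x, |g' t x| ≤ c' * wt x)
    (df : ∀ t x, HasDerivAt (fun s => f s x) (f' t x) t)
    (dg : ∀ t x, HasDerivAt (fun s => g s x) (g' t x) t) :
    ∀ t ∈ Ioo (0:ℝ) T, HasDerivAt
      (fun t => ∫ z : Rd d × Rd d, K (z.1 - z.2) * (f t z.1 * g t z.2))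
      ((∫ z : Rd d × Rd d, K (z.1 - z.2) * (f' t z.1 * g t z.2)) +
        ∫ z : Rd d × Rd d, K (z.1 - z.2) * (f t z.1 * g' t z.2)) t := by
  intro t ht
  obtain ⟨i0, -, b0, m0⟩ := prod_lem hK hC hf hg bf bg
  obtain ⟨i1, -, b1, m1⟩ := prod_lem hK hC hf' hg bf' bg
  obtain ⟨i2, -, b2, m2⟩ := prod_lem hK hC hf hg' bf bg'
  have htI := Ioo_subset_Icc_self ht
  rw [← integral_add (i1 t htI) (i2 t htI)]
  refine (hasDerivAt_integral_of_dominated_loc_of_deriv_le (s := Ioo 0 T)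
    (F := fun t (z : Rd d × Rd d) => K (z.1 - z.2) * (f t z.1 * g t z.2))
    (F' := fun t (z : Rd d × Rd d) => K (z.1 - z.2) * (f' t z.1 * g t z.2) +
      K (z.1 - z.2) * (f t z.1 * g' t z.2))
    (bound := fun z => C * ((c' * wt z.1) * (c * wt z.2)) + C * ((c * wt z.1) * (c' * wt z.2)))
    (Ioo_mem_nhds ht.1 ht.2)
    (Eventually.of_forall fun t => (m0 t).aestronglyMeasurable) (i0 t htI)
    ((m1 t).add (m2 t)).aestronglyMeasurable
    (Eventually.of_forall fun z s hs => ?_) ?_ (Eventually.of_forall fun z s hs => ?_)).2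
  · exact (norm_add_le _ _).trans
      (add_le_add (b1 s (Ioo_subset_Icc_self hs) z) (b2 s (Ioo_subset_Icc_self hs) z))
  · exact (((wt_integrable.const_mul c').mul_prod (wt_integrable.const_mul c)).const_mul C).add
      (((wt_integrable.const_mul c).mul_prod (wt_integrable.const_mul c')).const_mul C)
  · have := ((df s z.1).mul (dg s z.2)).const_mul (K (z.1 - z.2))
    rw [mul_add] at this
    exact this

lemma grad_coord {d : ℕ} (V : Rd d → ℝ) (y : Rd d) (a : Fin d) :
    (gradient V y) a = fderiv ℝ V y (EuclideanSpace.single a (1:ℝ)) := by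
  have h := InnerProductSpace.toDual_symm_apply (𝕜 := ℝ) (x := EuclideanSpace.single a (1:ℝ))
    (y := fderiv ℝ V y)
  rw [← h, EuclideanSpace.inner_single_right]
  simp [gradient]

lemma sp_lem {d : ℕ} {f V : Rd d → ℝ} (hf : ContDiff ℝ 1 f) {c C : ℝ}
    (bf : ∀ x, |f x| ≤ c * wt x) (bf' : ∀ x, ‖fderiv ℝ f x‖ ≤ c * wt x) (hV : GB C V)
    (hV' : ∀ a : Fin d, GB C (fun z => fderiv ℝ V z (EuclideanSpace.single a (1:ℝ)))) :
    (∀ x, |sdiv (fun y => f y • gradient V y) x| ≤ (d * (2 * (c * C))) * wt x) ∧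
    ∫ x, sdiv (fun y => f y • gradient V y) x * V x = - ∫ x, f x * ‖gradient V x‖ ^ 2 := by
  have hC := hV.nonneg
  set W : Fin d → Rd d → ℝ := fun a z => fderiv ℝ V z (EuclideanSpace.single a (1:ℝ)) with hW
  have hfd : Differentiable ℝ f := hf.differentiable one_ne_zero
  have hs : ∀ x, sdiv (fun y => f y • gradient V y) x =
      ∑ a : Fin d, fderiv ℝ (fun y => f y * W a y) x (EuclideanSpace.single a (1:ℝ)) := by
    intro x
    unfold _root_.sdiv
    refine Finset.sum_congr rfl fun a _ => ?_
    congr 2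
    ext y
    rw [PiLp.smul_apply, grad_coord, smul_eq_mul]
  have hfW : ∀ a, ContDiff ℝ 1 (fun y => f y * W a y) := fun a => hf.mul (hV' a).1
  have hb : ∀ a x, |fderiv ℝ (fun y => f y * W a y) x (EuclideanSpace.single a (1:ℝ))| ≤
      (2 * (c * C)) * wt x := by
    intro a x
    have hcw := (abs_nonneg _).trans (bf x)
    rw [fderiv_fun_mul (hfd x) ((hV' a).diff x), ← Real.norm_eq_abs]
    refine (ContinuousLinearMap.le_opNorm _ _).trans ?_
    rw [EuclideanSpace.norm_single, norm_one, mul_one]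
    refine (norm_add_le _ _).trans ?_
    rw [norm_smul, norm_smul]
    have e1 : ‖f x‖ * ‖fderiv ℝ (W a) x‖ ≤ (c * wt x) * C :=
      mul_le_mul (bf x) ((hV' a).2 x).2 (norm_nonneg _) hcw
    have e2 : ‖W a x‖ * ‖fderiv ℝ f x‖ ≤ C * (c * wt x) :=
      mul_le_mul ((hV' a).2 x).1 (bf' x) (norm_nonneg _) hC
    linarith
  have hcd : ∀ a, Continuous fun x =>
      fderiv ℝ (fun y => f y * W a y) x (EuclideanSpace.single a (1:ℝ)) := fun a =>
    ((hfW a).continuous_fderiv one_ne_zero).clm_apply continuous_const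
  have hVc : Continuous V := hV.1.continuous
  have hfc : Continuous f := hf.continuous
  have hWc : ∀ a, Continuous (W a) := fun a => (hV' a).1.continuous
  have j1 : ∀ a, Integrable fun x =>
      fderiv ℝ (fun y => f y * W a y) x (EuclideanSpace.single a (1:ℝ)) * V x := fun a => by
    refine int_of_wt (c := (2 * (c * C)) * C) ((hcd a).mul hVc) fun x => ?_
    rw [abs_mul]
    have := mul_le_mul (hb a x) (hV.2 x).1 (abs_nonneg _) ((abs_nonneg _).trans (hb a x))
    linarith
  have j2 : ∀ a, Integrable fun x => f x * W a x * W a x := fun a => by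
    refine int_of_wt (c := c * C * C) ((hfc.mul (hWc a)).mul (hWc a)) fun x => ?_
    rw [abs_mul, abs_mul]
    have e1 := mul_le_mul (bf x) ((hV' a).2 x).1 (abs_nonneg _) ((abs_nonneg _).trans (bf x))
    have := mul_le_mul e1 ((hV' a).2 x).1 (abs_nonneg _)
      ((mul_nonneg (abs_nonneg _) (abs_nonneg _)).trans e1)
    linarith
  have j3 : ∀ a, Integrable fun x => f x * W a x * V x := fun a => by
    refine int_of_wt (c := c * C * C) ((hfc.mul (hWc a)).mul hVc) fun x => ?_
    rw [abs_mul, abs_mul]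
    have e1 := mul_le_mul (bf x) ((hV' a).2 x).1 (abs_nonneg _) ((abs_nonneg _).trans (bf x))
    have := mul_le_mul e1 (hV.2 x).1 (abs_nonneg _)
      ((mul_nonneg (abs_nonneg _) (abs_nonneg _)).trans e1)
    linarith
  refine ⟨fun x => ?_, ?_⟩
  · rw [hs]
    refine (Finset.abs_sum_le_sum_abs _ _).trans ((Finset.sum_le_sum fun a _ => hb a x).trans ?_)
    simp [mul_assoc]
  · have e1 : ∀ x, f x * ‖gradient V x‖ ^ 2 = ∑ a, f x * W a x * W a x := by
      intro x
      rw [EuclideanSpace.norm_sq_eq, Finset.mul_sum]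
      refine Finset.sum_congr rfl fun a _ => ?_
      rw [grad_coord, Real.norm_eq_abs, sq_abs]
      ring
    simp_rw [e1, hs, Finset.sum_mul]
    rw [integral_finsetSum _ fun a _ => j1 a, integral_finsetSum _ fun a _ => j2 a,
      ← Finset.sum_neg_distrib]
    refine Finset.sum_congr rfl fun a _ => ?_
    have := integral_mul_fderiv_eq_neg_fderiv_mul_of_integrable (μ := volume)
      (f := fun y => f y * W a y) (g := V) (v := EuclideanSpace.single a (1:ℝ))
      (j1 a) (j2 a) (j3 a) (fun x _ => (hfW a).differentiable one_ne_zero x)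
      (fun x _ => hV.diff x)
    rw [this, neg_neg]

lemma en_core {d : ℕ} {φ ψ f g : Rd d → ℝ} (hφ : IsS φ) (hψ : IsS ψ) (hf : Continuous f)
    (hg : Continuous g) (fi : Integrable f) (gi : Integrable g) :
    Integrable (fun x => conv φ f x * conv ψ g x) ∧
    ∫ x, conv φ f x * conv ψ g x =
      ∫ z : Rd d × Rd d, conv (refle φ) ψ (z.1 - z.2) * (f z.1 * g z.2) := by
  obtain ⟨C, hC⟩ := hψ.gb
  have hφc : Continuous φ := hφ.gb.choose_spec.1.continuous
  have hψc : Continuous ψ := hC.1.continuous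
  let F : Rd d × Rd d → Rd d → ℝ := fun p x => (φ (x - p.1) * f p.1) * (ψ (x - p.2) * g p.2)
  have hFc : Continuous (Function.uncurry F) := by
    simp only [F, Function.uncurry_def]; fun_prop
  have b1 : ∀ p x, ‖F p x‖ ≤ (C * (|f p.1| * |g p.2|)) * |φ (x - p.1)| := fun p x => by
    simp only [F, norm_mul, Real.norm_eq_abs]
    have := mul_le_mul_of_nonneg_left (hC.2 (x - p.2)).1
      (by positivity : 0 ≤ |φ (x - p.1)| * |f p.1| * |g p.2|)
    linarith
  have ib : ∀ p : Rd d × Rd d, Integrable fun x => (C * (|f p.1| * |g p.2|)) * |φ (x - p.1)| :=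
    fun p => ((hφ.integrable.comp_sub_right p.1).abs).const_mul _
  have hFi : Integrable (Function.uncurry F) (volume.prod volume) := by
    rw [integrable_prod_iff hFc.aestronglyMeasurable]
    refine ⟨Eventually.of_forall fun p => (ib p).mono'
      (hFc.comp (by fun_prop : Continuous fun x => (p, x))).aestronglyMeasurable
      (Eventually.of_forall (b1 p)), ?_⟩
    have : Integrable (fun p : Rd d × Rd d => (C * ∫ x, |φ x|) * (|f p.1| * |g p.2|)) :=
      (fi.abs.mul_prod gi.abs).const_mul _
    refine this.mono' hFc.aestronglyMeasurable.norm.integral_prod_right'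
      (Eventually.of_forall fun p => ?_)
    rw [Real.norm_of_nonneg (integral_nonneg fun _ => norm_nonneg _)]
    refine (integral_mono_of_nonneg (Eventually.of_forall fun _ => norm_nonneg _) (ib p)
      (Eventually.of_forall (b1 p))).trans (le_of_eq ?_)
    rw [integral_const_mul, integral_sub_right_eq_self (fun x => |φ x|) p.1]
    ring
  have e : ∀ x, conv φ f x * conv ψ g x = ∫ p, F p x := fun x =>
    (integral_prod_mul (μ := volume) (ν := volume) (fun y => φ (x - y) * f y)
      (fun y => ψ (x - y) * g y)).symm
  refine ⟨?_, ?_⟩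
  · simp_rw [e]
    exact hFi.integral_prod_right
  · simp_rw [e]
    rw [← integral_integral_swap hFi]
    congr 1; ext p
    simp only [F, conv, refle]
    rw [← integral_add_right_eq_self _ p.2, ← integral_mul_const]
    congr 1; ext x
    rw [show -(p.1 - p.2 - x) = x + p.2 - p.1 by abel, add_sub_cancel_right]
    ring

lemma en_lem {d p N : ℕ} (A : Matrix (Fin p) (Fin N) ℝ) (φ : Fin N → Rd d → ℝ)
    (hφ : ∀ i, IsS (φ i)) (f : Fin N → Rd d → ℝ) (hf : ∀ i, Continuous (f i))
    (fi : ∀ i, Integrable (f i)) :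
    ∑ k, ∫ x, (∑ i, A k i * conv (φ i) (f i) x) ^ 2 =
      ∑ i, ∑ j, ∫ z : Rd d × Rd d, Kker A φ i j (z.1 - z.2) * (f i z.1 * f j z.2) := by
  have h := fun i j => en_core (hφ i) (hφ j) (hf i) (hf j) (fi i) (fi j)
  have e1 : ∀ k, ∫ x, (∑ i, A k i * conv (φ i) (f i) x) ^ 2 =
      ∑ i, ∑ j, (A k i * A k j) * ∫ x, conv (φ i) (f i) x * conv (φ j) (f j) x := by
    intro k
    have : ∀ x, (∑ i, A k i * conv (φ i) (f i) x) ^ 2 =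
        ∑ i, ∑ j, (A k i * A k j) * (conv (φ i) (f i) x * conv (φ j) (f j) x) := fun x => by
      rw [sq, Finset.sum_mul_sum]
      refine Finset.sum_congr rfl fun i _ => Finset.sum_congr rfl fun j _ => by ring
    simp_rw [this]
    rw [integral_finsetSum _ fun i _ => integrable_finsetSum _ fun j _ => (h i j).1.const_mul _]
    refine Finset.sum_congr rfl fun i _ => ?_
    rw [integral_finsetSum _ fun j _ => (h i j).1.const_mul _]
    exact Finset.sum_congr rfl fun j _ => integral_const_mul _ _
  simp_rw [e1]
  rw [Finset.sum_comm]
  refine Finset.sum_congr rfl fun i _ => ?_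
  rw [Finset.sum_comm]
  refine Finset.sum_congr rfl fun j _ => ?_
  rw [← Finset.sum_mul, (h i j).2, Kker_eq, ← integral_const_mul]
  congr 1; ext z; ring

/-- Energy dissipation identity for the multi-species nonlocal system. -/
theorem energy_dissipation_multi_species
    (d : ℕ) (hd : 2 ≤ d) (T ε : ℝ) (hT : 0 < T) (hε : 0 < ε)
    (N p : ℕ) (hN : 0 < N) (hNp : N ≤ p)
    (A : Matrix (Fin p) (Fin N) ℝ)
    (ρ : Fin N → Rd d → ℝ)
    (hρS : ∀ i, ∃ S : SchwartzMap (Rd d) ℝ, ⇑S = ρ i)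
    (hρpos : ∀ i x, 0 ≤ ρ i x) (hρint : ∀ i, ∫ x, ρ i x = 1)
    (u : Fin N → ℝ → Rd d → ℝ) (hupos : ∀ i t x, 0 ≤ u i t x)
    (husmooth : ∀ i, ContDiff ℝ (⊤ : ℕ∞) (fun q : ℝ × Rd d => u i q.1 q.2))
    (huS : ∀ i, SchwartzUnif T (u i))
    (hpde : ∀ i, ∀ t ∈ Icc (0:ℝ) T, ∀ x, deriv (fun s => u i s x) t
      = sdiv (fun y => u i t y • ∑ j : Fin N,
          gradient (conv (Kker A (fun l => resc ε (ρ l)) i j) (u j t)) y) x) :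
    ∀ t ∈ Icc (0:ℝ) T,
      (∑ k : Fin p, ∫ x, (∑ i : Fin N, A k i * conv (resc ε (ρ i)) (u i t) x) ^ 2)
        + 2 * ∑ i : Fin N, ∫ s in (0:ℝ)..t, ∫ x, u i s x *
            ‖∑ j : Fin N, gradient (conv (Kker A (fun l => resc ε (ρ l)) i j) (u j s)) x‖ ^ 2
      = ∑ k : Fin p, ∫ x, (∑ i : Fin N, A k i * conv (resc ε (ρ i)) (u i 0) x) ^ 2 := by
  classical
  set φ : Fin N → Rd d → ℝ := fun l => resc ε (ρ l) with hφdef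
  have hφ : ∀ i, IsS (φ i) := fun i => IsS.resc (hρS i) hε
  -- time derivative
  let u' : Fin N → ℝ → Rd d → ℝ := fun i t x => deriv (fun s => u i s x) t
  have hud : ∀ i t x, HasDerivAt (fun s => u i s x)
      (fderiv ℝ (fun q : ℝ × Rd d => u i q.1 q.2) (t, x) (1, 0)) t := by
    intro i t x
    have h1 : HasFDerivAt (fun q : ℝ × Rd d => u i q.1 q.2)
        (fderiv ℝ (fun q : ℝ × Rd d => u i q.1 q.2) (t, x)) (t, x) :=
      ((husmooth i).differentiable (by simp) (t, x)).hasFDerivAt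
    have h2 : HasDerivAt (fun s : ℝ => (s, x)) ((1 : ℝ), (0 : Rd d)) t :=
      (hasDerivAt_id t).prodMk (hasDerivAt_const t x)
    exact h1.comp_hasDerivAt t h2
  have hu'eq : ∀ i t x, u' i t x = fderiv ℝ (fun q : ℝ × Rd d => u i q.1 q.2) (t, x) (1, 0) :=
    fun i t x => (hud i t x).deriv
  have hu' : ∀ i t x, HasDerivAt (fun s => u i s x) (u' i t x) t := fun i t x => by
    rw [hu'eq]; exact hud i t x
  have hu'c : ∀ i, Continuous fun q : ℝ × Rd d => u' i q.1 q.2 := by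
    intro i
    simp only [hu'eq]
    exact ((husmooth i).continuous_fderiv (by simp)).clm_apply continuous_const
  have huc : ∀ i, Continuous fun q : ℝ × Rd d => u i q.1 q.2 := fun i => (husmooth i).continuous
  have hut : ∀ i t, ContDiff ℝ 1 (u i t) := fun i t =>
    ((husmooth i).of_le (by exact_mod_cast le_top)).comp
      (contDiff_const.prodMk contDiff_id : ContDiff ℝ 1 fun x : Rd d => (t, x))
  -- decay
  choose c0 n0 h0 using fun i => decay_lem (huS i) 0
  choose c1 n1 h1 using fun i => decay_lem (huS i) 1
  set c : ℝ := ∑ i, (c0 i + c1 i) with hc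
  have hcle : ∀ i, c0 i + c1 i ≤ c := fun i =>
    Finset.single_le_sum (f := fun i => c0 i + c1 i) (fun i _ => add_nonneg (n0 i) (n1 i))
      (Finset.mem_univ i)
  have bu : ∀ i, ∀ t ∈ Icc (0:ℝ) T, ∀ x, |u i t x| ≤ c * wt x := fun i t ht x => by
    have := h0 i t ht x
    rw [norm_iteratedFDeriv_zero] at this
    refine this.trans (mul_le_mul_of_nonneg_right ?_ (wt_nonneg x))
    linarith [hcle i, n1 i]
  have bdu : ∀ i, ∀ t ∈ Icc (0:ℝ) T, ∀ x, ‖fderiv ℝ (u i t) x‖ ≤ c * wt x := fun i t ht x => by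
    have := h1 i t ht x
    rw [norm_iteratedFDeriv_one] at this
    refine this.trans (mul_le_mul_of_nonneg_right ?_ (wt_nonneg x))
    linarith [hcle i, n0 i]
  have iu : ∀ i, ∀ t ∈ Icc (0:ℝ) T, Integrable (u i t) := fun i t ht =>
    int_of_wt (hut i t).continuous (bu i t ht)
  have hcn : 0 ≤ c := Finset.sum_nonneg fun i _ => add_nonneg (n0 i) (n1 i)
  set M : ℝ := c * ∫ x : Rd d, wt x with hMdef
  have hM : 0 ≤ M := mul_nonneg hcn (integral_nonneg wt_nonneg)
  have hMu : ∀ i, ∀ t ∈ Icc (0:ℝ) T, ∫ x, |u i t x| ≤ M := fun i t ht => by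
    rw [hMdef, ← integral_const_mul]
    exact integral_mono (iu i t ht).abs (wt_integrable.const_mul c) (bu i t ht)
  -- kernels
  have hK := fun i j => Kker_gb A φ hφ i j
  choose CV hV using fun i => V_lem (Kker A φ i) (fun j => (hK i j).1) (fun j => (hK i j).2) M hM
  set C : ℝ := ∑ i, |CV i| with hCdef
  have hCle : ∀ i, CV i ≤ C := fun i => (le_abs_self _).trans
    (Finset.single_le_sum (f := fun i => |CV i|) (fun i _ => abs_nonneg _) (Finset.mem_univ i))
  let V : Fin N → ℝ → Rd d → ℝ := fun i t x => ∑ j, conv (Kker A φ i j) (u j t) x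
  have hsp : ∀ i, ∀ t ∈ Icc (0:ℝ) T,
      (∀ x, |u' i t x| ≤ (d * (2 * (c * C))) * wt x) ∧
      ∫ x, u' i t x * V i t x = - ∫ x, u i t x *
        ‖∑ j : Fin N, gradient (conv (Kker A φ i j) (u j t)) x‖ ^ 2 := by
    intro i t ht
    obtain ⟨v1, v2, v3⟩ := hV i (fun j => u j t) (fun j => iu j t ht) (fun j => hMu j t ht)
    have := sp_lem (hut i t) (bu i t ht) (bdu i t ht) (v1.mono (hCle i))
      (fun a => (v2 a).mono (hCle i))
    have e : ∀ x, u' i t x = sdiv (fun y => u i t y •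
        gradient (fun x => ∑ j, conv (Kker A φ i j) (u j t) x) y) x := fun x => by
      rw [show u' i t x = _ from hpde i t ht x]
      simp_rw [v3]
    simp_rw [v3, e]
    exact this
  choose CK hCK using fun i j => (hK i j).1
  have hKc : ∀ i j, Continuous (Kker A φ i j) := fun i j => (hCK i j).1.continuous
  have hKb : ∀ i j x, |Kker A φ i j x| ≤ CK i j := fun i j x => ((hCK i j).2 x).1
  let E : Fin N → Fin N → ℝ → ℝ := fun i j t =>
    ∫ z : Rd d × Rd d, Kker A φ i j (z.1 - z.2) * (u i t z.1 * u j t z.2)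
  let G : Fin N → Fin N → ℝ → ℝ := fun i j t =>
    ∫ z : Rd d × Rd d, Kker A φ i j (z.1 - z.2) * (u' i t z.1 * u j t z.2)
  have bu' := fun i t ht => (hsp i t ht).1
  have pE := fun i j => prod_lem (hKc i j) (hKb i j) (huc i) (huc j) (bu i) (bu j)
  have pG := fun i j => prod_lem (hKc i j) (hKb i j) (hu'c i) (huc j) (bu' i) (bu j)
  have hE : ∀ i j, ContinuousOn (E i j) (Icc 0 T) := fun i j => (pE i j).2.1
  have hG : ∀ i j, ContinuousOn (G i j) (Icc 0 T) := fun i j => (pG i j).2.1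
  have hED : ∀ i j, ∀ t ∈ Ioo (0:ℝ) T, HasDerivAt (E i j) (G i j t + G j i t) t := by
    intro i j t ht
    have h := deriv_lem (hKc i j) (hKb i j) (huc i) (huc j) (hu'c i) (hu'c j) (bu i) (bu j)
      (bu' i) (bu' j) (hu' i) (hu' j) t ht
    have e : ∫ z : Rd d × Rd d, Kker A φ i j (z.1 - z.2) * (u i t z.1 * u' j t z.2) = G j i t := by
      refine (integral_prod_swap (μ := volume) (ν := volume) _).symm.trans ?_
      refine integral_congr_ae (Eventually.of_forall fun z => ?_)
      simp only [Prod.fst_swap, Prod.snd_swap]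
      rw [Kker_symm, neg_sub, mul_comm (u i t z.2)]
    rw [e] at h
    exact h
  have hD : ∀ i, ∀ t ∈ Icc (0:ℝ) T, ∫ x, u i t x *
        ‖∑ j : Fin N, gradient (conv (Kker A φ i j) (u j t)) x‖ ^ 2 = - ∑ j, G i j t := by
    intro i t ht
    refine neg_injective ?_
    rw [neg_neg, ← (hsp i t ht).2]
    have e : ∀ j x, ∫ y, Kker A φ i j (x - y) * (u' i t x * u j t y) =
        u' i t x * conv (Kker A φ i j) (u j t) x := fun j x => by
      rw [conv, ← integral_const_mul]
      congr 1; ext y; ring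
    have e1 : ∀ j, G i j t = ∫ x, u' i t x * conv (Kker A φ i j) (u j t) x := fun j => by
      refine (integral_prod _ ((pG i j).1 t ht)).trans ?_
      simp only [e]
    have e2 : ∀ j, Integrable fun x => u' i t x * conv (Kker A φ i j) (u j t) x := fun j => by
      have := ((pG i j).1 t ht).integral_prod_left
      simpa only [e] using this
    simp only [V, Finset.mul_sum]
    rw [integral_finsetSum _ fun j _ => e2 j]
    simp only [e1]
  intro t ht
  have hsub : Icc 0 t ⊆ Icc 0 T := Icc_subset_Icc_right ht.2
  have hen : ∀ s ∈ Icc (0:ℝ) T, ∑ k : Fin p, ∫ x, (∑ i : Fin N, A k i * conv (φ i) (u i s) x) ^ 2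
      = ∑ i, ∑ j, E i j s := fun s hs =>
    en_lem A φ hφ (fun i => u i s) (fun i => (hut i s).continuous) (fun i => iu i s hs)
  have hGi : ∀ i j, IntervalIntegrable (G i j) volume 0 t := fun i j =>
    ((hG i j).mono hsub).intervalIntegrable_of_Icc ht.1
  have hftc : ∀ i j, (∫ s in (0:ℝ)..t, G i j s) + ∫ s in (0:ℝ)..t, G j i s =
      E i j t - E i j 0 := fun i j => by
    rw [← intervalIntegral.integral_add (hGi i j) (hGi j i)]
    exact intervalIntegral.integral_eq_sub_of_hasDerivAt_of_le ht.1 ((hE i j).mono hsub)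
      (fun s hs => hED i j s ⟨hs.1, hs.2.trans_le ht.2⟩) ((hGi i j).add (hGi j i))
  have hDi : ∀ i, ∫ s in (0:ℝ)..t, ∫ x, u i s x *
        ‖∑ j : Fin N, gradient (conv (Kker A φ i j) (u j s)) x‖ ^ 2 =
      - ∑ j, ∫ s in (0:ℝ)..t, G i j s := fun i => by
    rw [← intervalIntegral.integral_finsetSum fun j _ => hGi i j, ← intervalIntegral.integral_neg]
    refine intervalIntegral.integral_congr fun s hs => ?_
    rw [uIcc_of_le ht.1] at hs
    exact hD i s (hsub hs)
  have hsum : 2 * ∑ i, ∑ j, ∫ s in (0:ℝ)..t, G i j s = ∑ i, ∑ j, E i j t - ∑ i, ∑ j, E i j 0 := by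
    rw [← Finset.sum_sub_distrib]
    simp_rw [← Finset.sum_sub_distrib, ← hftc, Finset.sum_add_distrib]
    rw [two_mul]
    congr 1
    exact Finset.sum_comm
  have e0 := hen 0 ⟨le_rfl, hT.le⟩
  have et := hen t ht
  refine (congrArg₂ (· + ·) et
    (congrArg (2 * ·) (Finset.sum_congr rfl fun i _ => hDi i))).trans (Eq.trans ?_ e0.symm)
  simp only [Finset.sum_neg_distrib]
  linarith
end
end
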